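/- Suppose every buyer has a CES substitutes utility with 0 < ρ_i < 1 (no linear utilities) and all buyers repeatedly update by the Proportional Response rule b_ij^{t+1} = e_i · a_ij (b_ij^t/p_j(b^t))^{ρ_i} / Σ_k a_ik (b_ik^t/p_k(b^t))^{ρ_i}, starting from an entrywise positive feasible b^0. Let σ = min_i (1 − ρ_i) and let b* be a minimizer of Φ over the feasible set. Then for all T ≥ 1: Φ(b^T) − Φ(b*) ≤ ( σ(1−σ)^T / (1 − (1−σ)^T) ) · Σ_i (1/ρ_i)·KL(b_i* ‖ b_i^0). -/

import Mathlib

open Finset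

/-- Price of good `j` given spending `b`. -/
noncomputable def price {m n : ℕ} (b : Fin m → Fin n → ℝ) (j : Fin n) : ℝ :=
  ∑ i, b i j

/-- KL divergence between two nonnegative vectors. -/
noncomputable def KL {n : ℕ} (x y : Fin n → ℝ) : ℝ :=
  ∑ j, x j * Real.log (x j / y j)

/-- Feasible spending: nonnegative entries, each buyer spends exactly her budget. -/
def Feasible {m n : ℕ} (e : Fin m → ℝ) (b : Fin m → Fin n → ℝ) : Prop :=
  ∀ i, (∀ j, 0 ≤ b i j) ∧ ∑ j, b i j = e i

/-- The potential function `Φ` for CES substitutes buyers. -/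
noncomputable def Phi {m n : ℕ} (a : Fin m → Fin n → ℝ) (ρ : Fin m → ℝ)
    (b : Fin m → Fin n → ℝ) : ℝ :=
  -∑ i, (1 / ρ i) * ∑ j, b i j * Real.log (a i j * b i j ^ (ρ i - 1) / price b j ^ ρ i)

/-- The Bregman divergence of the entropy weighted by `1 / ρ i`. -/
noncomputable def weightedKL {m n : ℕ} (ρ : Fin m → ℝ) (x y : Fin m → Fin n → ℝ) : ℝ :=
  ∑ i, (1 / ρ i) * KL (x i) (y i)

theorem sub_le_mul_log_div {x y : ℝ} (hx : 0 ≤ x) (hy : 0 < y) :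
    x - y ≤ x * Real.log (x / y) := by
  rcases hx.eq_or_lt with rfl | hx
  · simpa using hy.le
  · have h := mul_le_mul_of_nonneg_left
      (Real.one_sub_inv_le_log_of_pos (div_pos hx hy)) hx.le
    have h' : x * (1 - (x / y)⁻¹) = x - y := by field_simp
    linarith

theorem KL_nonneg {n : ℕ} {x y : Fin n → ℝ} (hx : ∀ j, 0 ≤ x j) (hy : ∀ j, 0 < y j)
    (hxy : ∑ j, x j = ∑ j, y j) : 0 ≤ KL x y := by
  have h := sum_le_sum fun j (_ : j ∈ univ) ↦ sub_le_mul_log_div (hx j) (hy j)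
  rw [sum_sub_distrib, hxy, sub_self] at h
  exact h

/-- The log sum inequality. -/
theorem sum_mul_log_div_sum_le {ι : Type*} {s : Finset ι} {x y : ι → ℝ}
    (hx : ∀ i ∈ s, 0 ≤ x i) (hy : ∀ i ∈ s, 0 < y i) :
    (∑ i ∈ s, x i) * Real.log ((∑ i ∈ s, x i) / ∑ i ∈ s, y i) ≤
      ∑ i ∈ s, x i * Real.log (x i / y i) := by
  rcases (sum_nonneg hx).eq_or_lt with hX | hX
  · have hx0 := (sum_eq_zero_iff_of_nonneg hx).1 hX.symm
    rw [← hX, zero_mul, sum_eq_zero fun i hi ↦ by rw [hx0 i hi, zero_mul]]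
  · have hY : 0 < ∑ i ∈ s, y i :=
      sum_pos hy (nonempty_of_sum_ne_zero hX.ne')
    set X := ∑ i ∈ s, x i with hXdef
    set Y := ∑ i ∈ s, y i with hYdef
    have hterm : ∀ i ∈ s, x i - y i * (X / Y) ≤
        x i * Real.log (x i / y i) - x i * Real.log (X / Y) := by
      intro i hi
      have h := sub_le_mul_log_div (hx i hi) (mul_pos (hy i hi) (div_pos hX hY))
      rcases (hx i hi).eq_or_lt with h0 | h0
      · simpa [← h0] using h
      · rwa [← div_div, Real.log_div (div_pos h0 (hy i hi)).ne' (div_pos hX hY).ne',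
          mul_sub] at h
    have h := sum_le_sum hterm
    rw [sum_sub_distrib, sum_sub_distrib, ← sum_mul, ← sum_mul, ← hXdef, ← hYdef,
      mul_div_cancel₀ X hY.ne'] at h
    linarith

theorem price_pos {m n : ℕ} [Nonempty (Fin m)] {b : Fin m → Fin n → ℝ}
    (hb : ∀ i j, 0 < b i j) (j : Fin n) : 0 < price b j :=
  sum_pos (fun i _ ↦ hb i j) univ_nonempty

/-- The divergence of prices is at most the divergence of spendings. -/
theorem KL_price_le {m n : ℕ} {x y : Fin m → Fin n → ℝ}
    (hx : ∀ i j, 0 ≤ x i j) (hy : ∀ i j, 0 < y i j) :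
    KL (price x) (price y) ≤ ∑ i, KL (x i) (y i) := by
  unfold KL price
  rw [sum_comm]
  exact sum_le_sum fun j _ ↦
    sum_mul_log_div_sum_le (fun i _ ↦ hx i j) fun i _ ↦ hy i j

/-- One Proportional Response step from `y`. -/
noncomputable def proportionalResponse {m n : ℕ} (e : Fin m → ℝ) (a : Fin m → Fin n → ℝ)
    (ρ : Fin m → ℝ) (y : Fin m → Fin n → ℝ) (i : Fin m) (j : Fin n) : ℝ :=
  e i * (a i j * (y i j / price y j) ^ ρ i) / ∑ k, a i k * (y i k / price y k) ^ ρ i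

section Step

variable {m n : ℕ} {e : Fin m → ℝ} {a : Fin m → Fin n → ℝ} {ρ : Fin m → ℝ}
  {y : Fin m → Fin n → ℝ}

theorem weightedKL_nonneg (hρ : ∀ i, 0 < ρ i) {x : Fin m → Fin n → ℝ} (hx : Feasible e x)
    (hyf : Feasible e y) (hy : ∀ i j, 0 < y i j) : 0 ≤ weightedKL ρ x y :=
  sum_nonneg fun i _ ↦ mul_nonneg (one_div_pos.2 (hρ i)).le
    (KL_nonneg (hx i).1 (hy i) ((hx i).2.trans (hyf i).2.symm))

theorem weightedKL_self (hy : ∀ i j, 0 < y i j) : weightedKL ρ y y = 0 := by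
  unfold weightedKL KL
  refine sum_eq_zero fun i _ ↦ ?_
  rw [sum_eq_zero fun j _ ↦ by rw [div_self (hy i j).ne', Real.log_one, mul_zero], mul_zero]

variable [Nonempty (Fin m)]

theorem proportionalResponse_weight_pos (ha : ∀ i j, 0 < a i j) (hy : ∀ i j, 0 < y i j)
    (i : Fin m) (j : Fin n) : 0 < a i j * (y i j / price y j) ^ ρ i :=
  mul_pos (ha i j) (Real.rpow_pos_of_pos (div_pos (hy i j) (price_pos hy j)) _)

variable [Nonempty (Fin n)]

theorem proportionalResponse_denom_pos (ha : ∀ i j, 0 < a i j) (hy : ∀ i j, 0 < y i j)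
    (i : Fin m) : 0 < ∑ k, a i k * (y i k / price y k) ^ ρ i :=
  sum_pos (fun k _ ↦ proportionalResponse_weight_pos ha hy i k) univ_nonempty

theorem proportionalResponse_pos (he : ∀ i, 0 < e i) (ha : ∀ i j, 0 < a i j)
    (hy : ∀ i j, 0 < y i j) (i : Fin m) (j : Fin n) : 0 < proportionalResponse e a ρ y i j :=
  div_pos (mul_pos (he i) (proportionalResponse_weight_pos ha hy i j))
    (proportionalResponse_denom_pos ha hy i)

theorem proportionalResponse_feasible (he : ∀ i, 0 < e i) (ha : ∀ i j, 0 < a i j)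
    (hy : ∀ i j, 0 < y i j) : Feasible e (proportionalResponse e a ρ y) := by
  refine fun i ↦ ⟨fun j ↦ (proportionalResponse_pos he ha hy i j).le, ?_⟩
  unfold proportionalResponse
  rw [← sum_div, ← mul_sum, mul_div_cancel_right₀ _ (proportionalResponse_denom_pos ha hy i).ne']

/-- The potential in terms of divergences from `y` and from the Proportional Response to `y`;
the last summand does not depend on `x`. -/
theorem Phi_eq (he : ∀ i, 0 < e i) (ha : ∀ i j, 0 < a i j)
    (hρ : ∀ i, 0 < ρ i) (hy : ∀ i j, 0 < y i j) {x : Fin m → Fin n → ℝ}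
    (hx : Feasible e x) :
    Phi a ρ x = weightedKL ρ x (proportionalResponse e a ρ y) - ∑ i, KL (x i) (y i) +
      KL (price x) (price y) +
      ∑ i, (1 / ρ i) *
        (e i * Real.log (e i / ∑ k, a i k * (y i k / price y k) ^ ρ i)) := by
  have hprice : KL (price x) (price y) =
      ∑ i, ∑ j, x i j * Real.log (price x j / price y j) := by
    rw [sum_comm]
    unfold KL
    exact sum_congr rfl fun j _ ↦ sum_mul univ (fun i ↦ x i j) _
  rw [hprice]
  unfold Phi weightedKL KL
  rw [← sum_neg_distrib, ← sum_sub_distrib, ← sum_add_distrib, ← sum_add_distrib]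
  refine sum_congr rfl fun i _ ↦ ?_
  set Z := ∑ k, a i k * (y i k / price y k) ^ ρ i
  have hZ : 0 < Z := proportionalResponse_denom_pos ha hy i
  have hbudget : e i * Real.log (e i / Z) = ∑ j, x i j * Real.log (e i / Z) := by
    rw [← sum_mul, (hx i).2]
  rw [hbudget, mul_sum, mul_sum, mul_sum, ← sum_neg_distrib, ← sum_sub_distrib,
    ← sum_add_distrib, ← sum_add_distrib]
  refine sum_congr rfl fun j _ ↦ ?_
  rcases ((hx i).1 j).eq_or_lt with h0 | h0
  · simp [← h0]
  have hpx : 0 < price x j :=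
    h0.trans_le (single_le_sum (f := fun i ↦ x i j) (fun i _ ↦ (hx i).1 j) (mem_univ i))
  have hpy := price_pos hy j
  have hyij := hy i j
  have haij := ha i j
  have hρi := hρ i
  have hlog : Real.log (proportionalResponse e a ρ y i j) = Real.log (e i) +
      (Real.log (a i j) + ρ i * (Real.log (y i j) - Real.log (price y j))) - Real.log Z := by
    have hw := Real.rpow_pos_of_pos (div_pos hyij hpy) (ρ i)
    rw [proportionalResponse, Real.log_div (mul_pos (he i) (mul_pos haij hw)).ne' hZ.ne',
      Real.log_mul (he i).ne' (mul_pos haij hw).ne', Real.log_mul haij.ne' hw.ne',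
      Real.log_rpow (div_pos hyij hpy), Real.log_div hyij.ne' hpy.ne']
  have hxr := Real.rpow_pos_of_pos h0 (ρ i - 1)
  rw [Real.log_div h0.ne' (proportionalResponse_pos he ha hy i j).ne', hlog,
    Real.log_div (mul_pos haij hxr).ne' (Real.rpow_pos_of_pos hpx _).ne',
    Real.log_mul haij.ne' hxr.ne', Real.log_rpow h0, Real.log_rpow hpx,
    Real.log_div h0.ne' hyij.ne', Real.log_div hpx.ne' hpy.ne', Real.log_div (he i).ne' hZ.ne']
  field_simp
  ring

/-- The mirror descent inequality for one Proportional Response step. -/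
theorem Phi_proportionalResponse_le (he : ∀ i, 0 < e i) (ha : ∀ i j, 0 < a i j)
    (hρ : ∀ i, 0 < ρ i) {σ : ℝ} (hσ : ∀ i, σ ≤ 1 - ρ i)
    (hyf : Feasible e y) (hy : ∀ i j, 0 < y i j) {x : Fin m → Fin n → ℝ} (hx : Feasible e x) :
    Phi a ρ (proportionalResponse e a ρ y) ≤
      Phi a ρ x + (1 - σ) * weightedKL ρ x y -
        weightedKL ρ x (proportionalResponse e a ρ y) := by
  have hf := proportionalResponse_feasible (ρ := ρ) he ha hy
  have hpos := proportionalResponse_pos (ρ := ρ) he ha hy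
  have hp : 0 ≤ KL (price x) (price y) := by
    refine KL_nonneg (fun j ↦ sum_nonneg fun i _ ↦ (hx i).1 j) (price_pos hy) ?_
    unfold price
    rw [sum_comm, sum_comm (f := fun j i ↦ y i j)]
    exact sum_congr rfl fun i _ ↦ (hx i).2.trans (hyf i).2.symm
  have hKL : ∑ i, KL (x i) (y i) ≤ (1 - σ) * weightedKL ρ x y := by
    unfold weightedKL
    rw [mul_sum]
    refine sum_le_sum fun i _ ↦ ?_
    have hi := KL_nonneg (hx i).1 (hy i) ((hx i).2.trans (hyf i).2.symm)
    have hr : 1 ≤ (1 - σ) * (1 / ρ i) := by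
      rw [mul_one_div, le_div_iff₀ (hρ i)]
      linarith [hσ i]
    rw [← mul_assoc]
    exact le_mul_of_one_le_left hi hr
  rw [Phi_eq he ha hρ hy hf, Phi_eq he ha hρ hy hx, weightedKL_self hpos]
  linarith [KL_price_le (fun i ↦ (hf i).1) hy]

/-- Proportional Response does not increase the potential. -/
theorem Phi_proportionalResponse_le_self (he : ∀ i, 0 < e i) (ha : ∀ i j, 0 < a i j)
    (hρ : ∀ i, 0 < ρ i) {σ : ℝ} (hσ : ∀ i, σ ≤ 1 - ρ i)
    (hyf : Feasible e y) (hy : ∀ i j, 0 < y i j) :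
    Phi a ρ (proportionalResponse e a ρ y) ≤ Phi a ρ y := by
  have h := Phi_proportionalResponse_le he ha hρ hσ hyf hy hyf
  rw [weightedKL_self hy] at h
  linarith [weightedKL_nonneg hρ hyf (proportionalResponse_feasible (ρ := ρ) he ha hy)
    (proportionalResponse_pos (ρ := ρ) he ha hy)]

end Step

/-- Linear convergence of Proportional Response in the strict CES
substitutes domain `0 < ρ_i < 1`, with `σ = min_i (1 - ρ_i)`. -/
theorem proportional_response_substitutes_linear {m n : ℕ}
    (e : Fin m → ℝ) (he : ∀ i, 0 < e i)
    (a : Fin m → Fin n → ℝ) (ha : ∀ i j, 0 < a i j)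
    (ρ : Fin m → ℝ) (hρ : ∀ i, 0 < ρ i ∧ ρ i < 1)
    (b : ℕ → Fin m → Fin n → ℝ)
    (hb0pos : ∀ i j, 0 < b 0 i j) (hb0 : Feasible e (b 0))
    -- the Proportional Response update
    (hupd : ∀ t i j, b (t + 1) i j =
      e i * (a i j * (b t i j / price (b t) j) ^ ρ i) /
        ∑ k, a i k * (b t i k / price (b t) k) ^ ρ i)
    -- σ = min_i (1 - ρ_i)
    (σ : ℝ) (hσle : ∀ i, σ ≤ 1 - ρ i) (hσmem : ∃ i, σ = 1 - ρ i)
    -- b* minimizes Φ over the feasible set (equilibrium spending)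
    (bstar : Fin m → Fin n → ℝ) (hbstarFeas : Feasible e bstar)
    (hbstarMin : ∀ b', Feasible e b' → Phi a ρ bstar ≤ Phi a ρ b')
    (T : ℕ) (hT : 1 ≤ T) :
    Phi a ρ (b T) - Phi a ρ bstar ≤
      σ * (1 - σ) ^ T / (1 - (1 - σ) ^ T) *
        ∑ i, (1 / ρ i) * KL (bstar i) (b 0 i) := by
  obtain ⟨i₀, hi₀⟩ := hσmem
  have : Nonempty (Fin m) := ⟨i₀⟩
  have : Nonempty (Fin n) := by
    by_contra hn
    have := not_nonempty_iff.1 hn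
    have h := (hb0 i₀).2
    rw [univ_eq_empty, sum_empty] at h
    exact (he i₀).ne h
  have hσ0 : 0 < σ := by linarith [(hρ i₀).2]
  have hσ1 : σ < 1 := by linarith [(hρ i₀).1]
  have hρ0 : ∀ i, 0 < ρ i := fun i ↦ (hρ i).1
  have hstep : ∀ t, b (t + 1) = proportionalResponse e a ρ (b t) := fun t ↦
    funext fun i ↦ funext fun j ↦ hupd t i j
  have hb : ∀ t, Feasible e (b t) ∧ ∀ i j, 0 < b t i j := by
    intro t
    induction t with
    | zero => exact ⟨hb0, hb0pos⟩
    | succ t ih =>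
      rw [hstep]
      exact ⟨proportionalResponse_feasible he ha ih.2, proportionalResponse_pos he ha ih.2⟩
  have hmain : ∀ t, (Phi a ρ (b t) - Phi a ρ bstar) * (∑ k ∈ range t, (1 - σ) ^ k) +
      weightedKL ρ bstar (b t) ≤ (1 - σ) ^ t * weightedKL ρ bstar (b 0) := by
    intro t
    induction t with
    | zero => simp
    | succ t ih =>
      have h1 := Phi_proportionalResponse_le he ha hρ0 hσle (hb t).1 (hb t).2 hbstarFeas
      have h2 := Phi_proportionalResponse_le_self he ha hρ0 hσle (hb t).1 (hb t).2
      rw [← hstep] at h1 h2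
      have hS : 0 ≤ (1 - σ) * ∑ k ∈ range t, (1 - σ) ^ k :=
        mul_nonneg (by linarith) (sum_nonneg fun k _ ↦ pow_nonneg (by linarith) k)
      have h3 := mul_le_mul_of_nonneg_right h2 hS
      have h4 := mul_le_mul_of_nonneg_left ih (by linarith : 0 ≤ 1 - σ)
      rw [geom_sum_succ, pow_succ]
      linarith
  have hq : (1 - σ) ^ T < 1 := pow_lt_one₀ (by linarith) (by linarith) (by omega)
  have hS : σ * ∑ k ∈ range T, (1 - σ) ^ k = 1 - (1 - σ) ^ T := by
    have h := mul_neg_geom_sum (1 - σ) T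
    rwa [sub_sub_cancel] at h
  have hT' := mul_le_mul_of_nonneg_left (hmain T) hσ0.le
  have hd := mul_nonneg hσ0.le (weightedKL_nonneg hρ0 hbstarFeas (hb T).1 (hb T).2)
  change _ ≤ _ * weightedKL ρ bstar (b 0)
  rw [div_mul_eq_mul_div, le_div_iff₀ (by linarith), ← hS]
  linarith
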